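/- Let W be a symmetric and singular discrete memoryless channel with R_cr < C(W). Then for any rate R with R_∞ < R < C(W) there exists a constant K̃₂ > 0 (depending only on W and R) such that for every blocklength N ∈ ℤ⁺, the minimum average error probability of codes with ideal feedback satisfies P̄_{e,fb}(N,R) ≥ (K̃₂/√N) · exp(−N·E_SP(R)). -/

import Mathlib

open Real Finset

variable {X Y : Type} [Fintype X] [Fintype Y]

/-- A discrete memoryless channel: `W x y` is the probability of output `y` given input `x`. -/
def IsDMC (W : X → Y → ℝ) : Prop :=
  (∀ x y, 0 ≤ W x y) ∧ ∀ x, ∑ y, W x y = 1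

/-- A probability distribution on a finite alphabet. -/
def IsProbDist (Q : X → ℝ) : Prop :=
  (∀ x, 0 ≤ Q x) ∧ ∑ x, Q x = 1

/-- Gallager symmetry: the output alphabet can be partitioned into classes such that within
each class every row is a permutation of every other row, and every column is a permutation
of every other column. -/
def GallagerSymmetric (W : X → Y → ℝ) : Prop :=
  ∃ cls : Y → ℕ,
    (∀ (l : ℕ) (x x' : X),
        ((Finset.univ.filter fun y => cls y = l).val.map fun y => W x y) =
        ((Finset.univ.filter fun y => cls y = l).val.map fun y => W x' y)) ∧
    (∀ y y' : Y, cls y = cls y' →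
        (Finset.univ.val.map fun x => W x y) = (Finset.univ.val.map fun x => W x y'))

/-- Singularity: whenever two inputs both give an output positive probability,
they give it the same probability. -/
def Singular (W : X → Y → ℝ) : Prop :=
  ∀ x z y, 0 < W x y * W z y → W x y = W z y

/-- Gallager's function `E_o(ρ, Q)`. -/
noncomputable def Eo (W : X → Y → ℝ) (Q : X → ℝ) (ρ : ℝ) : ℝ :=
  - Real.log (∑ y, (∑ x, Q x * W x y ^ (1 / (1 + ρ))) ^ (1 + ρ))

/-- Mutual information `I(Q; W)`. -/
noncomputable def mutualInfo (W : X → Y → ℝ) (Q : X → ℝ) : ℝ :=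
  ∑ x, ∑ y, Q x * W x y * Real.log (W x y / ∑ z, Q z * W z y)

/-- Channel capacity `C(W)`. -/
noncomputable def capacity (W : X → Y → ℝ) : ℝ :=
  sSup {r | ∃ Q, IsProbDist Q ∧ r = mutualInfo W Q}

/-- The set of values whose supremum is the sphere-packing exponent. -/
def ESPset (W : X → Y → ℝ) (R : ℝ) : Set ℝ :=
  {e | ∃ Q, IsProbDist Q ∧ ∃ ρ : ℝ, 0 ≤ ρ ∧ e = Eo W Q ρ - ρ * R}

/-- The sphere-packing exponent `E_SP(R) = max_Q sup_{ρ ≥ 0} (E_o(ρ,Q) - ρ R)`. -/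
noncomputable def ESP (W : X → Y → ℝ) (R : ℝ) : ℝ := sSup (ESPset W R)

/-- The random coding exponent `E_r(R) = max_Q max_{0 ≤ ρ ≤ 1} (E_o(ρ,Q) - ρ R)`. -/
noncomputable def Er (W : X → Y → ℝ) (R : ℝ) : ℝ :=
  sSup {e | ∃ Q, IsProbDist Q ∧ ∃ ρ : ℝ, 0 ≤ ρ ∧ ρ ≤ 1 ∧ e = Eo W Q ρ - ρ * R}

/-- `R_∞`: the supremum of rates at which the sphere-packing exponent is infinite
(i.e. the defining supremum is unbounded). -/
noncomputable def Rinf (W : X → Y → ℝ) : ℝ :=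
  sSup {R | ¬ BddAbove (ESPset W R)}

/-- The critical rate `R_cr`: the smallest rate above which `E_r = E_SP`. -/
noncomputable def Rcr (W : X → Y → ℝ) : ℝ :=
  sInf {R | ∀ R', R ≤ R' → Er W R' = ESP W R'}

/-- Number of messages of an `(N, R)` code: `⌈e^{NR}⌉`. -/
noncomputable def Mof (N : ℕ) (R : ℝ) : ℕ := ⌈Real.exp (N * R)⌉₊

/-- Error probability of message `m` for a (non-feedback) block code. -/
noncomputable def msgErrorProb (W : X → Y → ℝ) {N M : ℕ}
    (f : Fin M → Fin N → X) (φ : (Fin N → Y) → Fin M) (m : Fin M) : ℝ :=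
  ∑ y ∈ Finset.univ.filter (fun y : Fin N → Y => φ y ≠ m), ∏ n, W (f m n) (y n)

/-- Average error probability of a (non-feedback) block code. -/
noncomputable def avgErrorProb (W : X → Y → ℝ) {N M : ℕ}
    (f : Fin M → Fin N → X) (φ : (Fin N → Y) → Fin M) : ℝ :=
  (M : ℝ)⁻¹ * ∑ m, msgErrorProb W f φ m

/-- A feedback encoder, given as a function of the whole output word, is causal if the symbol
sent at time `n` depends only on the message and the outputs at times `< n`. -/
def Causal {N M : ℕ} (f : Fin M → (Fin N → Y) → Fin N → X) : Prop :=
  ∀ m y y' n, (∀ k, k < n → y k = y' k) → f m y n = f m y' n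

/-- Average error probability of a feedback code. -/
noncomputable def avgErrorProbFb (W : X → Y → ℝ) {N M : ℕ}
    (f : Fin M → (Fin N → Y) → Fin N → X) (φ : (Fin N → Y) → Fin M) : ℝ :=
  (M : ℝ)⁻¹ * ∑ m, ∑ y ∈ Finset.univ.filter (fun y : Fin N → Y => φ y ≠ m),
      ∏ n, W (f m y n) (y n)

/-- Expectation of `g (s + U ω₁ + ⋯ + U ωₙ)` for `n` independent letters with weights `ν`. -/
noncomputable def walk {Ω G : Type*} [Fintype Ω] [Add G] (ν : Ω → ℝ) (U : Ω → G) :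
    ℕ → (G → ℝ) → G → ℝ
  | 0, g, s => g s
  | n + 1, g, s => ∑ ω, ν ω * walk ν U n g (s + U ω)

section Walk

variable {Ω G : Type*} [Fintype Ω]

lemma walk_mono [Add G] {ν : Ω → ℝ} (hν : ∀ ω, 0 ≤ ν ω) (U : Ω → G) {g h : G → ℝ}
    (hgh : ∀ s, g s ≤ h s) (n : ℕ) (s : G) : walk ν U n g s ≤ walk ν U n h s := by
  induction n generalizing s with
  | zero => exact hgh s
  | succ n ih => exact sum_le_sum fun ω _ => mul_le_mul_of_nonneg_left (ih _) (hν ω)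

lemma walk_nonneg [Add G] {ν : Ω → ℝ} (hν : ∀ ω, 0 ≤ ν ω) (U : Ω → G) {g : G → ℝ}
    (hg : ∀ s, 0 ≤ g s) (n : ℕ) (s : G) : 0 ≤ walk ν U n g s := by
  induction n generalizing s with
  | zero => exact hg s
  | succ n ih => exact sum_nonneg fun ω _ => mul_nonneg (hν ω) (ih _)

lemma walk_const_mul [Add G] (ν : Ω → ℝ) (U : Ω → G) (c : ℝ) (g : G → ℝ) (n : ℕ) (s : G) :
    walk ν U n (fun t => c * g t) s = c * walk ν U n g s := by
  induction n generalizing s with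
  | zero => rfl
  | succ n ih =>
    simp only [walk, ih, mul_sum]
    exact sum_congr rfl fun ω _ => by ring

lemma walk_sub [Add G] (ν : Ω → ℝ) (U : Ω → G) (g h : G → ℝ) (n : ℕ) (s : G) :
    walk ν U n (fun t => g t - h t) s = walk ν U n g s - walk ν U n h s := by
  induction n generalizing s with
  | zero => rfl
  | succ n ih => simp only [walk, ih, mul_sub, sum_sub_distrib]

lemma walk_const [Add G] {ν : Ω → ℝ} (hν : ∑ ω, ν ω = 1) (U : Ω → G) (c : ℝ) (n : ℕ) (s : G) :
    walk ν U n (fun _ => c) s = c := by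
  induction n generalizing s with
  | zero => rfl
  | succ n ih => simp only [walk, ih, ← sum_mul, hν, one_mul]

lemma walk_sum_translate {ι : Type*} [Fintype ι] [AddCommSemigroup G] (ν : Ω → ℝ) (U : Ω → G)
    (c : ι → ℝ) (u : ι → G) (g : G → ℝ) (n : ℕ) (s : G) :
    walk ν U n (fun t => ∑ i, c i * g (t + u i)) s = ∑ i, c i * walk ν U n g (s + u i) := by
  induction n generalizing s with
  | zero => rfl
  | succ n ih =>
    simp only [walk, ih, mul_sum]
    rw [sum_comm]
    refine sum_congr rfl fun i _ => sum_congr rfl fun ω _ => ?_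
    rw [add_right_comm s (U ω) (u i)]
    ring

lemma walk_sq [Add G] {ν : Ω → ℝ} (hν : ∑ ω, ν ω = 1) (U : Ω → G) {L : G → ℝ}
    (hL : ∀ x y, L (x + y) = L x + L y) {μ : ℝ} (hμ : ∑ ω, ν ω * L (U ω) = μ)
    (n : ℕ) (c : ℝ) (s : G) :
    walk ν U n (fun t => (L t - c) ^ 2) s =
      (L s - c + n * μ) ^ 2 + n * ∑ ω, ν ω * (L (U ω) - μ) ^ 2 := by
  induction n generalizing s with
  | zero => simp [walk]
  | succ n ih =>
    set V := ∑ ω, ν ω * (L (U ω) - μ) ^ 2 with hV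
    have hV' : V = ∑ ω, ν ω * L (U ω) ^ 2 - μ ^ 2 := by
      have : ∀ ω, ν ω * (L (U ω) - μ) ^ 2 =
          ν ω * L (U ω) ^ 2 - 2 * μ * (ν ω * L (U ω)) + μ ^ 2 * ν ω := fun ω => by ring
      rw [hV, sum_congr rfl fun ω _ => this ω, sum_add_distrib, sum_sub_distrib, ← mul_sum,
        ← mul_sum, hμ, hν]
      ring
    have h1 : ∀ ω, ν ω * ((L (s + U ω) - c + n * μ) ^ 2 + n * V) =
        ((L s - c + n * μ) ^ 2 + n * V) * ν ω + 2 * (L s - c + n * μ) * (ν ω * L (U ω)) +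
          ν ω * L (U ω) ^ 2 := fun ω => by rw [hL]; ring
    simp only [walk, ih]
    rw [sum_congr rfl fun ω _ => h1 ω, sum_add_distrib, sum_add_distrib, ← mul_sum, ← mul_sum,
      hμ, hν]
    push_cast
    linarith [hV']

lemma walk_tilt {ν ν' : Ω → ℝ} (U : Ω → ℝ) {ρ Φ : ℝ}
    (h : ∀ ω, ν ω = Φ * ν' ω * exp (ρ * U ω)) (g : ℝ → ℝ) (n : ℕ) (s : ℝ) :
    walk ν U n g s = Φ ^ n * exp (-(ρ * s)) * walk ν' U n (fun t => exp (ρ * t) * g t) s := by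
  induction n generalizing s with
  | zero => simp [walk, ← mul_assoc, ← exp_add]
  | succ n ih =>
    simp only [walk, ih, mul_sum]
    refine sum_congr rfl fun ω _ => ?_
    have : exp (-(ρ * (s + U ω))) = exp (-(ρ * s)) * (exp (ρ * U ω))⁻¹ := by
      rw [← exp_neg, ← exp_add]; congr 1; ring
    rw [h, this]
    have := (exp_pos (ρ * U ω)).ne'
    field_simp
    ring

lemma walk_pos {ν : Ω → ℝ} (hν : ∀ ω, 0 ≤ ν ω) {U : Ω → ℝ} {g : ℝ → ℝ} (hg : ∀ s, 0 ≤ g s)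
    (hg' : ∀ s < 0, 0 < g s) {ω₀ : Ω} (h0 : 0 < ν ω₀) (hU : U ω₀ < 0) (n : ℕ) (s : ℝ)
    (hs : s < 0) : 0 < walk ν U n g s := by
  induction n generalizing s with
  | zero => exact hg' s hs
  | succ n ih =>
    exact (mul_pos h0 (ih (s + U ω₀) (by linarith))).trans_le
      (single_le_sum (f := fun ω => ν ω * walk ν U n g (s + U ω))
        (fun ω _ => mul_nonneg (hν ω) (walk_nonneg hν U hg n _)) (mem_univ ω₀))

lemma sum_prod_mul_eq_walk (ν : Ω → ℝ) (U : Ω → ℝ) (g : ℝ → ℝ) (n : ℕ) (s : ℝ) :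
    ∑ y : Fin n → Ω, (∏ i, ν (y i)) * g (s + ∑ i, U (y i)) = walk ν U n g s := by
  induction n generalizing s with
  | zero => simp [walk]
  | succ n ih =>
    rw [← (Fin.consEquiv fun _ => Ω).sum_comp, Fintype.sum_prod_type]
    refine sum_congr rfl fun ω _ => ?_
    rw [← ih, mul_sum]
    refine sum_congr rfl fun y _ => ?_
    rw [Fin.prod_univ_succ, Fin.sum_univ_succ]
    simp only [Fin.consEquiv_apply, Fin.cons_zero, Fin.cons_succ]
    rw [mul_assoc, add_assoc]

end Walk

section Binomial

lemma sixteen_pow_le_centralBinom_sq {n : ℕ} (hn : 1 ≤ n) :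
    (16 : ℝ) ^ n ≤ 4 * n * (n.centralBinom : ℝ) ^ 2 := by
  induction n, hn using Nat.le_induction with
  | base => norm_num [Nat.centralBinom_eq_two_mul_choose]
  | succ n hn ih =>
    have h : ((n : ℝ) + 1) * ((n + 1).centralBinom : ℝ) = 2 * (2 * n + 1) * n.centralBinom := by
      exact_mod_cast Nat.succ_mul_centralBinom_succ n
    have hn0 : (0 : ℝ) < n := by exact_mod_cast hn
    have h2 : ((n : ℝ) + 1) * (4 * (n + 1) * ((n + 1).centralBinom : ℝ) ^ 2) =
        16 * (2 * n + 1) ^ 2 * (n.centralBinom : ℝ) ^ 2 := by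
      have := congrArg (fun t : ℝ => 4 * t ^ 2) h
      linarith
    have h3 : ((n : ℝ) + 1) * (16 * (4 * n * (n.centralBinom : ℝ) ^ 2)) ≤
        16 * (2 * n + 1) ^ 2 * (n.centralBinom : ℝ) ^ 2 := by
      nlinarith [sq_nonneg (n.centralBinom : ℝ)]
    have h4 : ((n : ℝ) + 1) * (16 : ℝ) ^ (n + 1) ≤
        ((n : ℝ) + 1) * (16 * (4 * n * (n.centralBinom : ℝ) ^ 2)) := by
      rw [pow_succ]
      have : (0 : ℝ) < n + 1 := by positivity
      nlinarith
    push_cast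
    exact le_of_mul_le_mul_left (h4.trans (h3.trans h2.ge)) (by positivity)

lemma four_pow_div_le_centralBinom {n : ℕ} (hn : 1 ≤ n) :
    (4 : ℝ) ^ n / (2 * √n) ≤ n.centralBinom := by
  have hn0 : (0 : ℝ) < n := by exact_mod_cast hn
  have hs : (0 : ℝ) < √n := sqrt_pos.2 hn0
  rw [div_le_iff₀ (by positivity)]
  refine abs_le_of_sq_le_sq' ?_ (by positivity) |>.2
  have h := sixteen_pow_le_centralBinom_sq hn
  rw [← pow_mul, mul_comm n 2, pow_mul, mul_pow, mul_pow, sq_sqrt hn0.le]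
  norm_num
  linarith

lemma centralBinom_mul_pow_le_choose {m I : ℕ} (hI : I < m) (i : ℕ) (hi : i ≤ I) :
    (m.centralBinom : ℝ) * (((m : ℝ) - I) / (m + I)) ^ i ≤ ((2 * m).choose (m + i) : ℝ) := by
  have hm : (I : ℝ) < m := by exact_mod_cast hI
  have hI0 : (0 : ℝ) ≤ I := Nat.cast_nonneg I
  induction i with
  | zero => simp [Nat.centralBinom_eq_two_mul_choose]
  | succ i ih =>
    have hi' : (i : ℝ) + 1 ≤ I := by exact_mod_cast hi
    have hi0 : (0 : ℝ) ≤ i := Nat.cast_nonneg i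
    have h := Nat.choose_succ_right_eq (2 * m) (m + i)
    have hsub : 2 * m - (m + i) = m - i := by omega
    rw [hsub] at h
    have h' : ((2 * m).choose (m + i + 1) : ℝ) * (m + i + 1) =
        (2 * m).choose (m + i) * ((m : ℝ) - i) := by
      have := congrArg (Nat.cast (R := ℝ)) h
      rw [Nat.cast_mul, Nat.cast_mul, Nat.cast_sub (by omega)] at this
      exact_mod_cast this
    have hr : ((m : ℝ) - I) / (m + I) ≤ ((m : ℝ) - i) / (m + i + 1) := by
      apply div_le_div₀ <;> linarith
    have hc : ((2 * m).choose (m + (i + 1)) : ℝ) =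
        (2 * m).choose (m + i) * (((m : ℝ) - i) / (m + i + 1)) := by
      rw [← mul_div_assoc, ← h', ← add_assoc, mul_div_cancel_right₀ _ (by positivity)]
    rw [hc, pow_succ, ← mul_assoc]
    refine mul_le_mul (ih (by omega)) hr ?_ (Nat.cast_nonneg _)
    exact div_nonneg (by linarith) (by linarith)

lemma centralBinom_mul_exp_le_choose {m I : ℕ} (hm : 0 < m) (hI : 2 * I ≤ m) :
    (m.centralBinom : ℝ) * exp (-(4 * I ^ 2 / m)) ≤ ((2 * m).choose (m + I) : ℝ) := by
  refine le_trans (mul_le_mul_of_nonneg_left ?_ (Nat.cast_nonneg _))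
    (centralBinom_mul_pow_le_choose (I := I) (by omega) I le_rfl)
  have hm' : (0 : ℝ) < m := by exact_mod_cast hm
  have hI' : 2 * (I : ℝ) ≤ m := by exact_mod_cast hI
  have hI0 : (0 : ℝ) ≤ I := Nat.cast_nonneg I
  have h1 : ((m : ℝ) + I) / (m - I) ≤ exp (4 * I / m) := by
    refine le_trans ?_ (add_one_le_exp _)
    rw [div_add_one hm'.ne', div_le_div_iff₀ (by linarith) hm']
    nlinarith
  have h2 : exp (-(4 * I / m)) ≤ ((m : ℝ) - I) / (m + I) := by
    rw [exp_neg, ← inv_div ((m : ℝ) + I)]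
    exact inv_anti₀ (div_pos (by linarith) (by linarith)) h1
  calc exp (-(4 * I ^ 2 / m)) = exp (-(4 * I / m)) ^ I := by
        rw [← exp_nat_mul]; congr 1; ring
    _ ≤ _ := pow_le_pow_left₀ (exp_pos _).le h2 _

/-- Binomial coefficients within `O(√k)` of the centre are at least of order `2 ^ k / √k`. -/
lemma exists_le_choose_div {D : ℝ} (hD : 0 < D) :
    ∃ c : ℝ, 0 < c ∧ ∃ k₀ : ℕ, ∀ k : ℕ, k₀ ≤ k → ∀ j : ℕ, |(j : ℝ) - k / 2| ≤ D * √k →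
      c / √k ≤ (k.choose j : ℝ) / 2 ^ k := by
  set E : ℝ := 2 * (D + 1) with hE
  refine ⟨exp (-(4 * E ^ 2)) / 4, by positivity, 2 * ⌈4 * E ^ 2⌉₊ + 2, fun k hk j hj => ?_⟩
  set m := k / 2 with hmdef
  have hm1 : 1 ≤ m := by omega
  have hmE : 4 * E ^ 2 ≤ m := by
    refine (Nat.le_ceil _).trans ?_
    exact_mod_cast (by omega : ⌈4 * E ^ 2⌉₊ ≤ m)
  have hm0 : (0 : ℝ) < m := by exact_mod_cast hm1
  have hk1 : (1 : ℝ) ≤ k := by exact_mod_cast (by omega : 1 ≤ k)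
  have hk3 : (k : ℝ) ≤ 3 * m := by exact_mod_cast (by omega : k ≤ 3 * m)
  have hkm : (m : ℝ) ≤ k := by exact_mod_cast (by omega : m ≤ k)
  have hsk : √(k : ℝ) ≤ 2 * √m := by
    rw [show (2 : ℝ) = √4 by rw [show (4 : ℝ) = 2 ^ 2 by norm_num]; simp,
      ← sqrt_mul (by norm_num)]
    exact sqrt_le_sqrt (by linarith)
  have hsk1 : 1 ≤ √(k : ℝ) := one_le_sqrt.2 hk1
  obtain ⟨I, hI⟩ : ∃ I : ℕ, j = m + I ∨ m = j + I := by
    rcases le_total m j with h | h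
    · exact ⟨j - m, Or.inl (by omega)⟩
    · exact ⟨m - j, Or.inr (by omega)⟩
  have hhalf : |(k : ℝ) / 2 - m| ≤ 1 / 2 := by
    rcases (by omega : k = 2 * m ∨ k = 2 * m + 1) with h | h <;> rw [h] <;> push_cast <;>
      rw [abs_le] <;> constructor <;> linarith
  have hIabs : (I : ℝ) = |(j : ℝ) - m| := by
    rcases hI with h | h <;> rw [h] <;> push_cast <;> simp
  have hIle : (I : ℝ) ≤ E * √m := by
    rw [hIabs]
    calc |(j : ℝ) - m| ≤ |(j : ℝ) - k / 2| + |(k : ℝ) / 2 - m| := abs_sub_le _ _ _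
      _ ≤ D * √k + 1 * √k := by linarith
      _ ≤ E * √m := by rw [hE]; nlinarith
  have hI2 : (I : ℝ) ^ 2 ≤ E ^ 2 * m := by
    calc (I : ℝ) ^ 2 ≤ (E * √m) ^ 2 := pow_le_pow_left₀ (Nat.cast_nonneg _) hIle 2
      _ = E ^ 2 * m := by rw [mul_pow, sq_sqrt hm0.le]
  have h2I : 2 * I ≤ m := by
    have : (2 * (I : ℝ)) ^ 2 ≤ (m : ℝ) ^ 2 := by nlinarith
    have := abs_le_of_sq_le_sq' this hm0.le |>.2
    exact_mod_cast this
  have hch : (2 * m).choose (m + I) = (2 * m).choose j := by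
    rcases hI with h | h
    · rw [h]
    · exact Nat.choose_symm_of_eq_add (by omega)
  have h1 : (4 : ℝ) ^ m / (2 * √m) * exp (-(4 * E ^ 2)) ≤ ((2 * m).choose j : ℝ) := by
    rw [← hch]
    refine le_trans (mul_le_mul (four_pow_div_le_centralBinom hm1) ?_ (exp_pos _).le
      (Nat.cast_nonneg _)) (centralBinom_mul_exp_le_choose hm1 h2I)
    refine exp_le_exp.2 (neg_le_neg ?_)
    rw [div_le_iff₀ hm0]
    nlinarith
  have h2 : ((2 * m).choose j : ℝ) ≤ k.choose j := by
    exact_mod_cast Nat.choose_le_choose j (by omega)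
  have h3 : (2 : ℝ) ^ k ≤ 2 * 4 ^ m := by
    calc (2 : ℝ) ^ k ≤ 2 ^ (2 * m + 1) := pow_le_pow_right₀ (by norm_num) (by omega)
      _ = 2 * 4 ^ m := by rw [pow_succ, pow_mul]; norm_num; ring
  have hsm : 0 < √(m : ℝ) := sqrt_pos.2 hm0
  rw [le_div_iff₀ (by positivity)]
  calc exp (-(4 * E ^ 2)) / 4 / √k * 2 ^ k
      ≤ exp (-(4 * E ^ 2)) / 4 / √m * (2 * 4 ^ m) := by gcongr
    _ = (4 : ℝ) ^ m / (2 * √m) * exp (-(4 * E ^ 2)) := by field_simp; ring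
    _ ≤ _ := h1.trans h2

end Binomial
section Local

/-- The walk taking steps `a` and `b` with probability `1 / 2` each. -/
noncomputable abbrev coinWalk (a b : ℝ) : ℕ → (ℝ → ℝ) → ℝ → ℝ :=
  walk (fun _ : Bool => (1 / 2 : ℝ)) fun t => cond t b a

lemma coinWalk_succ (a b : ℝ) (k : ℕ) (g : ℝ → ℝ) (s : ℝ) :
    coinWalk a b (k + 1) g s =
      1 / 2 * coinWalk a b k g (s + b) + 1 / 2 * coinWalk a b k g (s + a) := by
  simp [coinWalk, walk]

lemma choose_mul_le_coinWalk (a b : ℝ) {g : ℝ → ℝ} (hg : ∀ s, 0 ≤ g s) (k j : ℕ) (s : ℝ) :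
    (k.choose j : ℝ) / 2 ^ k * g (s + (k - j) * a + j * b) ≤ coinWalk a b k g s := by
  have hnn : ∀ k s, 0 ≤ coinWalk a b k g s :=
    fun k s => walk_nonneg (fun _ => by norm_num) _ hg k s
  induction k generalizing j s with
  | zero =>
    cases j with
    | zero => simp [walk]
    | succ j => simpa [walk] using hg s
  | succ k ih =>
    rw [coinWalk_succ]
    cases j with
    | zero =>
      have h := ih 0 (s + a)
      have e : s + a + ((k : ℝ) - (0 : ℕ)) * a + (0 : ℕ) * b =
          s + ((k + 1 : ℕ) - (0 : ℕ)) * a + (0 : ℕ) * b := by push_cast; ring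
      rw [e] at h
      have := hnn k (s + b)
      simp only [Nat.choose_zero_right] at h ⊢
      rw [pow_succ, ← div_div]
      linarith
    | succ j =>
      have h1 := ih j (s + b)
      have h2 := ih (j + 1) (s + a)
      have e1 : s + b + ((k : ℝ) - j) * a + j * b =
          s + ((k + 1 : ℕ) - (j + 1 : ℕ)) * a + (j + 1 : ℕ) * b := by push_cast; ring
      have e2 : s + a + ((k : ℝ) - (j + 1 : ℕ)) * a + (j + 1 : ℕ) * b =
          s + ((k + 1 : ℕ) - (j + 1 : ℕ)) * a + (j + 1 : ℕ) * b := by push_cast; ring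
      rw [e1] at h1
      rw [e2] at h2
      rw [Nat.choose_succ_succ, Nat.cast_add, pow_succ, ← div_div, add_div, add_div, add_mul]
      linarith

lemma exists_le_coinWalk_window {a b A : ℝ} (hab : a < b) (hA0 : 0 ≤ A) {g : ℝ → ℝ}
    (hg : ∀ s, 0 ≤ g s) (hg1 : ∀ s, -1 - (b - a) ≤ s → s ≤ -1 → 1 ≤ g s) :
    ∃ c : ℝ, 0 < c ∧ ∃ k₀ : ℕ, ∀ k : ℕ, k₀ ≤ k → ∀ s : ℝ, |s + k * ((a + b) / 2)| ≤ A * √k →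
      c / √k ≤ coinWalk a b k g s := by
  set d := b - a with hd
  have hd0 : 0 < d := sub_pos.2 hab
  set m := (a + b) / 2 with hm
  set D : ℝ := (1 + A) / d + 1 with hD
  have hD0 : 0 < D := by positivity
  obtain ⟨c, hc, k₀, hk₀⟩ := exists_le_choose_div hD0
  refine ⟨c, hc, k₀ + ⌈4 * D ^ 2⌉₊ + 1, fun k hk s hb1' => ?_⟩
  have hk1 : (1 : ℝ) ≤ k := by exact_mod_cast (by omega : 1 ≤ k)
  have hk0 : (0 : ℝ) < k := by linarith
  have hsk1 : 1 ≤ √(k : ℝ) := one_le_sqrt.2 hk1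
  have hkD : 4 * D ^ 2 ≤ k := (Nat.le_ceil _).trans
    (by exact_mod_cast (by omega : ⌈4 * D ^ 2⌉₊ ≤ k))
  set x : ℝ := (-1 - s - k * a) / d with hx
  have hxk : x - k / 2 = (-1 - (s + k * m)) / d := by
    rw [hx, hm]
    field_simp
    rw [hd]
    ring
  have hxabs : |x - k / 2| + 1 ≤ D * √k := by
    have : |-1 - (s + k * m)| ≤ (1 + A) * √k := by
      calc |-1 - (s + k * m)| ≤ |(-1 : ℝ)| + |s + k * m| := abs_sub _ _
        _ = 1 + |s + k * m| := by norm_num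
        _ ≤ _ := by linarith
    rw [hxk, abs_div, abs_of_pos hd0, hD, add_mul, one_mul]
    have := div_le_div_of_nonneg_right this hd0.le
    rw [mul_div_right_comm] at this
    linarith
  have hDk : D * √k ≤ k / 2 := by
    have h2D : 2 * D ≤ √k := le_sqrt_of_sq_le (by nlinarith)
    nlinarith [mul_self_sqrt hk0.le]
  have hx0 : 0 ≤ x := by
    have := (abs_le.1 (show |x - k / 2| ≤ k / 2 by linarith)).1
    linarith
  have hf1 := Nat.floor_le hx0
  have hf2 := (Nat.lt_floor_add_one x).le
  have hj : |(⌊x⌋₊ : ℝ) - k / 2| ≤ D * √k := by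
    refine le_trans ?_ hxabs
    calc |(⌊x⌋₊ : ℝ) - k / 2| ≤ |(⌊x⌋₊ : ℝ) - x| + |x - k / 2| := abs_sub_le _ _ _
      _ ≤ 1 + |x - k / 2| := by
        gcongr
        rw [abs_le]; constructor <;> linarith
      _ = _ := add_comm _ _
  have hxd : x * d = -1 - s - k * a := by rw [hx, div_mul_cancel₀ _ hd0.ne']
  have hpos : s + ((k : ℝ) - ⌊x⌋₊) * a + ⌊x⌋₊ * b = s + k * a + ⌊x⌋₊ * d := by rw [hd]; ring
  have hg1' : 1 ≤ g (s + ((k : ℝ) - ⌊x⌋₊) * a + ⌊x⌋₊ * b) := by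
    rw [hpos]
    apply hg1
    · nlinarith
    · nlinarith
  refine le_trans ?_ (choose_mul_le_coinWalk a b hg k ⌊x⌋₊ s)
  exact (hk₀ k (by omega) _ hj).trans (le_mul_of_one_le_right (by positivity) hg1')

variable {Ω : Type*} [Fintype Ω]

/-- Splitting a walk whose step law contains a fair coin on `{a, b}` of total mass `2 ε`:
the coin tosses may be postponed to the end. -/
lemma walk_option_eq {ν ν' : Ω → ℝ} {U : Ω → ℝ} {a b ε : ℝ}
    (hsplit : ∀ h : ℝ → ℝ, ∀ s, ∑ ω, ν ω * h (s + U ω) =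
      ∑ ω, ν' ω * h (s + U ω) + ε * (h (s + b) + h (s + a))) (g : ℝ → ℝ) (N : ℕ) (s : ℝ) (k : ℕ) :
    walk (fun o : Option Ω => o.elim (2 * ε) ν')
      (fun o : Option Ω => o.elim ((0 : ℝ), 1) fun ω => (U ω, 0)) N
      (fun p : ℝ × ℕ => coinWalk a b p.2 g p.1) (s, k) = coinWalk a b k (walk ν U N g) s := by
  induction N generalizing s k with
  | zero => rfl
  | succ N ih =>
    have h1 : walk ν U (N + 1) g = fun t => ∑ ω, ν ω * walk ν U N g (t + U ω) := rfl
    rw [h1, coinWalk, walk_sum_translate, hsplit]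
    refine (Fintype.sum_option _).trans ?_
    simp only [Prod.mk_add_mk, Option.elim_none, Option.elim_some, add_zero, ih]
    rw [coinWalk_succ]
    ring

/-- Local lower bound for a centred, nondegenerate walk: the probability that it lands in a fixed
window of the length of a lattice step is at least of order `1 / √N`. -/
lemma exists_le_walk_window {ν : Ω → ℝ} (hν : ∀ ω, 0 ≤ ν ω) (hν1 : ∑ ω, ν ω = 1) {U : Ω → ℝ}
    (hU : ∑ ω, ν ω * U ω = 0) {ω₀ ω₁ : Ω} (h0 : 0 < ν ω₀) (h1 : 0 < ν ω₁) (h01 : U ω₀ < U ω₁)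
    {g : ℝ → ℝ} (hg : ∀ s, 0 ≤ g s)
    (hg1 : ∀ s, -1 - (U ω₁ - U ω₀) ≤ s → s ≤ -1 → 1 ≤ g s) :
    ∃ K : ℝ, 0 < K ∧ ∃ N₀ : ℕ, ∀ N : ℕ, N₀ ≤ N → K / √N ≤ walk ν U N g 0 := by
  classical
  set a := U ω₀ with ha
  set b := U ω₁ with hb
  set d := b - a with hd
  have hd0 : 0 < d := sub_pos.2 h01
  have hne : ω₀ ≠ ω₁ := fun h => by rw [ha, hb, h] at h01; exact lt_irrefl _ h01
  obtain ⟨ε, hε, hε0, hε1⟩ : ∃ ε : ℝ, 0 < ε ∧ ε ≤ ν ω₀ ∧ ε ≤ ν ω₁ :=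
    ⟨min (ν ω₀) (ν ω₁), lt_min h0 h1, min_le_left _ _, min_le_right _ _⟩
  have hε2 : 2 * ε ≤ 1 := by
    have : ∑ ω ∈ ({ω₀, ω₁} : Finset Ω), ν ω ≤ ∑ ω, ν ω :=
      sum_le_sum_of_subset_of_nonneg (subset_univ _) fun ω _ _ => hν ω
    rw [sum_pair hne, hν1] at this
    linarith
  set ν' : Ω → ℝ := fun ω => ν ω - (if ω = ω₀ then ε else 0) - (if ω = ω₁ then ε else 0) with hν'
  have hν'0 : ∀ ω, 0 ≤ ν' ω := by
    intro ω
    have := hν ω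
    by_cases e0 : ω = ω₀
    · have e1 : ω ≠ ω₁ := fun h => hne (e0 ▸ h)
      simp [hν', e0, hne, hε0]
    · by_cases e1 : ω = ω₁
      · simp [hν', e1, hne.symm, hε1]
      · simp [hν', e0, e1, this]
  have hsum : ∀ F : Ω → ℝ, ∑ ω, ν ω * F ω = ∑ ω, ν' ω * F ω + ε * (F ω₁ + F ω₀) := by
    intro F
    simp only [hν', sub_mul, sum_sub_distrib, ite_mul, zero_mul, sum_ite_eq', mem_univ, if_true]
    ring
  set m := (a + b) / 2 with hm
  set P : Option Ω → ℝ := fun o => o.elim (2 * ε) ν' with hP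
  set V : Option Ω → ℝ × ℕ := fun o => o.elim ((0 : ℝ), 1) fun ω => (U ω, 0) with hV
  have hP_nonneg : ∀ o, 0 ≤ P o := by
    rintro (_ | ω)
    · exact (by positivity : 0 ≤ 2 * ε)
    · exact hν'0 ω
  have hP_sum : ∑ o, P o = 1 := by
    have := hsum fun _ => 1
    simp only [mul_one, hν1] at this
    simp only [hP, Fintype.sum_option, Option.elim]
    linarith
  set L₁ : ℝ × ℕ → ℝ := fun p => p.1 + p.2 * m with hL₁
  set L₂ : ℝ × ℕ → ℝ := fun p => p.2 with hL₂
  have hL₁add : ∀ x y, L₁ (x + y) = L₁ x + L₁ y := fun x y => by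
    simp only [hL₁, Prod.fst_add, Prod.snd_add]; push_cast; ring
  have hL₂add : ∀ x y, L₂ (x + y) = L₂ x + L₂ y := fun x y => by
    simp only [hL₂, Prod.snd_add]; push_cast; ring
  have hmean₁ : ∑ o, P o * L₁ (V o) = 0 := by
    have := hsum U
    rw [hU] at this
    simp only [hP, hL₁, hV, Fintype.sum_option, Option.elim, Nat.cast_one, Nat.cast_zero,
      zero_mul, add_zero, one_mul, zero_add, hm]
    linarith
  have hmean₂ : ∑ o, P o * L₂ (V o) = 2 * ε := by
    simp [hP, hL₂, hV, Fintype.sum_option]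
  set σ₁ := ∑ o, P o * (L₁ (V o) - 0) ^ 2 with hσ₁
  set σ₂ := ∑ o, P o * (L₂ (V o) - 2 * ε) ^ 2 with hσ₂
  have hσ₁0 : 0 ≤ σ₁ := sum_nonneg fun o _ => mul_nonneg (hP_nonneg o) (sq_nonneg _)
  have hσ₂0 : 0 ≤ σ₂ := sum_nonneg fun o _ => mul_nonneg (hP_nonneg o) (sq_nonneg _)
  set α : ℝ := 1 / (4 * (σ₁ + 1)) with hα
  have hα0 : 0 < α := by positivity
  have hασ : α * σ₁ ≤ 1 / 4 := by
    rw [hα, div_mul_eq_mul_div, div_le_div_iff₀ (by positivity) (by norm_num)]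
    linarith
  set A : ℝ := √(1 / (α * ε)) with hA
  obtain ⟨c, hc, k₀, hk₀⟩ := exists_le_coinWalk_window h01 (sqrt_nonneg _ : 0 ≤ A) hg hg1
  refine ⟨c / 2 * (1 / 2), by positivity,
    ⌈(k₀ : ℝ) / ε⌉₊ + ⌈4 * σ₂ / ε ^ 2⌉₊ + ⌈1 / ε⌉₊ + 1, fun N hN => ?_⟩
  have hN1 : (1 : ℝ) ≤ N := by exact_mod_cast (by omega : 1 ≤ N)
  have hNk₀ : (k₀ : ℝ) ≤ ε * N := by
    have : (k₀ : ℝ) / ε ≤ N := (Nat.le_ceil _).trans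
      (by exact_mod_cast (by omega : ⌈(k₀ : ℝ) / ε⌉₊ ≤ N))
    rw [div_le_iff₀ hε] at this; linarith
  have hNσ : 4 * σ₂ ≤ ε ^ 2 * N := by
    have : 4 * σ₂ / ε ^ 2 ≤ N := (Nat.le_ceil _).trans
      (by exact_mod_cast (by omega : ⌈4 * σ₂ / ε ^ 2⌉₊ ≤ N))
    rw [div_le_iff₀ (by positivity)] at this; linarith
  have hNε : 1 ≤ ε * N := by
    have : 1 / ε ≤ N := (Nat.le_ceil _).trans
      (by exact_mod_cast (by omega : ⌈1 / ε⌉₊ ≤ N))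
    rw [div_le_iff₀ hε] at this; linarith
  have hN0 : (0 : ℝ) < N := by linarith
  have hsN : 0 < √(N : ℝ) := sqrt_pos.2 hN0
  set q : ℝ × ℕ → ℝ := fun p =>
    1 - α / N * (L₁ p - 0) ^ 2 - 1 / (ε ^ 2 * N ^ 2) * (L₂ p - 2 * ε * N) ^ 2 with hq
  have hqexp : 1 / 2 ≤ walk P V N q (0, 0) := by
    rw [hq, walk_sub P V (fun p => 1 - α / N * (L₁ p - 0) ^ 2), walk_sub P V (fun _ => 1),
      walk_const hP_sum, walk_const_mul, walk_const_mul, walk_sq hP_sum V hL₁add hmean₁,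
      walk_sq hP_sum V hL₂add hmean₂, ← hσ₁, ← hσ₂]
    have e1 : L₁ (0, 0) = 0 := by simp [hL₁]
    have e2 : L₂ (0, 0) = 0 := by simp [hL₂]
    have e3 : α / N * ((L₁ (0, 0) - 0 + N * 0) ^ 2 + N * σ₁) = α * σ₁ := by
      rw [e1]; field_simp; ring
    have e4 : 1 / (ε ^ 2 * (N : ℝ) ^ 2) * ((L₂ (0, 0) - 2 * ε * N + N * (2 * ε)) ^ 2 + N * σ₂) =
        σ₂ / (ε ^ 2 * N) := by
      rw [e2]; field_simp; ring
    have e5 : σ₂ / (ε ^ 2 * N) ≤ 1 / 4 := by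
      rw [div_le_div_iff₀ (by positivity) (by norm_num)]
      linarith
    rw [e3, e4]
    linarith
  have hmain : ∀ p : ℝ × ℕ, c / 2 / √N * q p ≤ coinWalk a b p.2 g p.1 := by
    rintro ⟨s, k⟩
    rcases le_or_gt (q (s, k)) 0 with hq0 | hq0
    · exact (mul_nonpos_of_nonneg_of_nonpos (by positivity) hq0).trans
        (walk_nonneg (fun _ => by norm_num) _ hg k s)
    have t1 : 0 ≤ α / N * (L₁ (s, k) - 0) ^ 2 := by positivity
    have t2 : 0 ≤ 1 / (ε ^ 2 * (N : ℝ) ^ 2) * (L₂ (s, k) - 2 * ε * N) ^ 2 := by positivity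
    have hq1 : q (s, k) ≤ 1 := by simp only [hq]; linarith
    have hb1 : α / N * (s + k * m) ^ 2 ≤ 1 := by
      simp only [hq, hL₁, sub_zero] at hq0 t1 t2 ⊢; linarith
    have hb2 : 1 / (ε ^ 2 * (N : ℝ) ^ 2) * ((k : ℝ) - 2 * ε * N) ^ 2 ≤ 1 := by
      simp only [hq, hL₂] at hq0 t1 t2 ⊢; linarith
    have hb2' : |(k : ℝ) - 2 * ε * N| ≤ ε * N := by
      rw [one_div, inv_mul_le_iff₀ (by positivity), mul_one, ← mul_pow] at hb2
      exact abs_le_of_sq_le_sq hb2 (by positivity)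
    rw [abs_le] at hb2'
    have hkε : ε * N ≤ k := by linarith
    have hk1 : (1 : ℝ) ≤ k := hNε.trans hkε
    have hk0 : (0 : ℝ) < k := by linarith
    have hk4 : (k : ℝ) ≤ 4 * N := by nlinarith
    have hkk : k₀ ≤ k := by exact_mod_cast hNk₀.trans hkε
    have hb1' : |s + k * m| ≤ A * √k := by
      rw [hA, ← sqrt_mul (by positivity)]
      refine abs_le_sqrt ?_
      rw [div_mul_eq_mul_div, div_le_one hN0] at hb1
      rw [div_mul_eq_mul_div, one_mul, le_div_iff₀ (by positivity)]
      calc (s + k * m) ^ 2 * (α * ε) = (α * (s + k * m) ^ 2) * ε := by ring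
        _ ≤ N * ε := by gcongr
        _ ≤ k := by linarith
    have hch := hk₀ k hkk s hb1'
    calc c / 2 / √N * q (s, k) ≤ c / 2 / √N := mul_le_of_le_one_right (by positivity) hq1
      _ = c / (2 * √N) := by rw [div_div]
      _ ≤ c / √k := by
        gcongr
        rw [show (2 : ℝ) = √4 by rw [show (4 : ℝ) = 2 ^ 2 by norm_num]; simp,
          ← sqrt_mul (by norm_num)]
        exact sqrt_le_sqrt hk4
      _ ≤ _ := hch
  have hwalk := walk_option_eq (ν := ν) (ν' := ν') (U := U) (a := a) (b := b) (ε := ε)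
    (fun h s => hsum fun ω => h (s + U ω)) g N 0 0
  calc c / 2 * (1 / 2) / √N = c / 2 / √N * (1 / 2) := by ring
    _ ≤ c / 2 / √N * walk P V N q (0, 0) := by gcongr
    _ = walk P V N (fun p => c / 2 / √N * q p) (0, 0) := (walk_const_mul _ _ _ _ _ _).symm
    _ ≤ walk P V N (fun p => coinWalk a b p.2 g p.1) (0, 0) := walk_mono hP_nonneg V hmain N _
    _ = walk ν U N g 0 := hwalk

end Local

section Channel

/-- The output distribution of `W` under the uniform input distribution. -/
noncomputable def outputDist (W : X → Y → ℝ) (y : Y) : ℝ := (∑ x, W x y) / Fintype.card X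

/-- The fraction of inputs from which the output `y` can be reached. -/
noncomputable def reachFrac (W : X → Y → ℝ) (y : Y) : ℝ :=
  ((Finset.univ.filter fun x => 0 < W x y).card : ℝ) / Fintype.card X

/-- For a singular channel, the information density of a reachable output. -/
noncomputable def infoDensity (W : X → Y → ℝ) (y : Y) : ℝ := -Real.log (reachFrac W y)

variable {W : X → Y → ℝ}

lemma outputDist_nonneg (hW : IsDMC W) (y : Y) : 0 ≤ outputDist W y :=
  div_nonneg (sum_nonneg fun x _ => hW.1 x y) (Nat.cast_nonneg _)

omit [Fintype Y] in
lemma reachFrac_pos [Nonempty X] {x : X} {y : Y} (h : 0 < W x y) : 0 < reachFrac W y := by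
  have : 0 < (Finset.univ.filter fun x => 0 < W x y).card := card_pos.2 ⟨x, by simp [h]⟩
  unfold reachFrac
  positivity

omit [Fintype Y] in
lemma exp_infoDensity [Nonempty X] {x : X} {y : Y} (h : 0 < W x y) :
    exp (infoDensity W y) = (reachFrac W y)⁻¹ := by
  rw [infoDensity, exp_neg, exp_log (reachFrac_pos h)]

lemma sum_apply_eq_of_pos (hW : IsDMC W) (hsing : Singular W) {x : X} {y : Y} (h : 0 < W x y)
    {F : ℝ → ℝ} (hF : F 0 = 0) :
    ∑ z, F (W z y) = (Finset.univ.filter fun z => 0 < W z y).card * F (W x y) := by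
  classical
  have : ∀ z, F (W z y) = if 0 < W z y then F (W x y) else 0 := by
    intro z
    split_ifs with hz
    · rw [hsing z x y (mul_pos hz h)]
    · rw [le_antisymm (not_lt.1 hz) (hW.1 z y), hF]
  rw [sum_congr rfl fun z _ => this z, ← sum_filter, sum_const, nsmul_eq_mul]

lemma outputDist_eq_of_pos (hW : IsDMC W) (hsing : Singular W) {x : X} {y : Y} (h : 0 < W x y) :
    outputDist W y = reachFrac W y * W x y := by
  rw [outputDist, show ∑ z, W z y = _ from sum_apply_eq_of_pos hW hsing h (F := fun t => t) rfl,
    reachFrac]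
  ring

omit [Fintype Y] in
lemma outputDist_eq_zero {y : Y} (h : ∀ x, W x y = 0) : outputDist W y = 0 := by
  simp [outputDist, h]

lemma eq_outputDist_mul_exp [Nonempty X] (hW : IsDMC W) (hsing : Singular W) {x : X} {y : Y}
    (h : 0 < W x y) : W x y = outputDist W y * exp (infoDensity W y) := by
  rw [exp_infoDensity h, outputDist_eq_of_pos hW hsing h]
  field_simp [(reachFrac_pos h).ne']

lemma le_outputDist_mul_exp [Nonempty X] (hW : IsDMC W) (hsing : Singular W) (x : X) (y : Y) :
    W x y ≤ outputDist W y * exp (infoDensity W y) := by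
  rcases (hW.1 x y).eq_or_lt with h | h
  · rw [← h]; exact mul_nonneg (outputDist_nonneg hW y) (exp_pos _).le
  · exact (eq_outputDist_mul_exp hW hsing h).le

lemma sum_mul_infoDensity_congr (hsym : GallagerSymmetric W) (F : ℝ → ℝ) (x x' : X) :
    ∑ y, W x y * F (infoDensity W y) = ∑ y, W x' y * F (infoDensity W y) := by
  classical
  obtain ⟨cls, hrow, hcol⟩ := hsym
  have hZ : ∀ y y', cls y = cls y' → infoDensity W y = infoDensity W y' := by
    intro y y' h
    have h1 := congrArg (fun s : Multiset ℝ => (s.map fun t => if 0 < t then 1 else 0).sum)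
      (hcol y y' h)
    simp only [Multiset.map_map, Function.comp_def] at h1
    rw [infoDensity, infoDensity, reachFrac, reachFrac, card_filter, card_filter]
    congr 4
  rw [← sum_fiberwise_of_maps_to (t := univ.image cls) (g := cls) fun y _ => mem_image_of_mem _
      (mem_univ y), ← sum_fiberwise_of_maps_to (t := univ.image cls) (g := cls)
      fun y _ => mem_image_of_mem _ (mem_univ y)]
  refine sum_congr rfl fun l hl => ?_
  obtain ⟨y₀, -, rfl⟩ := mem_image.1 hl
  have h1 : ∀ x, ∑ y ∈ univ.filter (fun y => cls y = cls y₀), W x y * F (infoDensity W y) =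
      ((Finset.univ.filter fun y => cls y = cls y₀).val.map fun y => W x y).sum *
        F (infoDensity W y₀) := by
    intro x
    change _ = (∑ y ∈ univ.filter (fun y => cls y = cls y₀), W x y) * _
    rw [sum_mul]
    exact sum_congr rfl fun y hy => by rw [hZ y y₀ (mem_filter.1 hy).2]
  rw [h1, h1, hrow _ x x']

lemma sum_mul_infoDensity_eq [Nonempty X] (hsym : GallagerSymmetric W) (F : ℝ → ℝ) (x : X) :
    ∑ y, W x y * F (infoDensity W y) = ∑ y, outputDist W y * F (infoDensity W y) := by
  have hX : (Fintype.card X : ℝ) ≠ 0 := by simp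
  have : ∑ y, outputDist W y * F (infoDensity W y) =
      (∑ x', ∑ y, W x' y * F (infoDensity W y)) / Fintype.card X := by
    rw [sum_comm, sum_div]
    exact sum_congr rfl fun y _ => by rw [outputDist, ← sum_mul, div_mul_eq_mul_div]
  rw [this, sum_congr rfl fun x' _ => sum_mul_infoDensity_congr hsym F x' x, sum_const, card_univ,
    nsmul_eq_mul, mul_div_cancel_left₀ _ hX]

lemma sum_outputDist [Nonempty X] (hW : IsDMC W) : ∑ y, outputDist W y = 1 := by
  simp only [outputDist]
  rw [← sum_div, sum_comm, sum_congr rfl fun x _ => hW.2 x]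
  simp

lemma Eo_uniform [Nonempty X] (hW : IsDMC W) (hsing : Singular W) {ρ : ℝ} (hρ : 0 ≤ ρ) :
    Eo W (fun _ => 1 / Fintype.card X) ρ =
      -Real.log (∑ y, outputDist W y * exp (-(ρ * infoDensity W y))) := by
  have hρ1 : (1 + ρ) ≠ 0 := by positivity
  rw [Eo]
  congr 2
  refine sum_congr rfl fun y _ => ?_
  by_cases h : ∃ x, 0 < W x y
  · obtain ⟨x, hx⟩ := h
    have hδ := reachFrac_pos hx
    have h1 : ∑ x, 1 / (Fintype.card X : ℝ) * W x y ^ (1 / (1 + ρ)) =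
        reachFrac W y * W x y ^ (1 / (1 + ρ)) := by
      rw [← mul_sum, sum_apply_eq_of_pos hW hsing hx (F := fun t => t ^ (1 / (1 + ρ)))
        (zero_rpow (by positivity)), reachFrac]
      ring
    rw [h1, mul_rpow hδ.le (by positivity), ← rpow_mul hx.le, one_div_mul_cancel hρ1, rpow_one,
      outputDist_eq_of_pos hW hsing hx, infoDensity, rpow_add hδ, rpow_one, rpow_def_of_pos hδ]
    rw [show -(ρ * -Real.log (reachFrac W y)) = Real.log (reachFrac W y) * ρ by ring]
    ring
  · have h0 : ∀ x, W x y = 0 := fun x =>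
      le_antisymm (not_lt.1 fun hx => h ⟨x, hx⟩) (hW.1 x y)
    have hinv : 1 / (1 + ρ) ≠ 0 := by positivity
    simp only [h0, zero_rpow hinv, mul_zero, sum_const_zero, zero_rpow hρ1, outputDist_eq_zero h0,
      zero_mul]

lemma isProbDist_uniform [Nonempty X] : IsProbDist fun _ : X => 1 / (Fintype.card X : ℝ) :=
  ⟨fun _ => by positivity, by simp⟩

lemma Eo_le_mul_log_card [Nonempty X] (hW : IsDMC W) {Q : X → ℝ} (hQ : IsProbDist Q) {ρ : ℝ}
    (hρ : 0 ≤ ρ) : Eo W Q ρ ≤ (1 + ρ) * Real.log (Fintype.card X) := by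
  have hX : (0 : ℝ) < Fintype.card X := by positivity
  have hρ1 : (0 : ℝ) < 1 + ρ := by positivity
  obtain ⟨x, -, hx⟩ : ∃ x ∈ (univ : Finset X), 1 / (Fintype.card X : ℝ) ≤ Q x :=
    exists_le_of_sum_le univ_nonempty (by rw [hQ.2]; simp)
  have hQx : 0 < Q x := lt_of_lt_of_le (by positivity) hx
  have h1 : (1 / (Fintype.card X : ℝ)) ^ (1 + ρ) ≤
      ∑ y, (∑ x, Q x * W x y ^ (1 / (1 + ρ))) ^ (1 + ρ) := by
    calc (1 / (Fintype.card X : ℝ)) ^ (1 + ρ) ≤ Q x ^ (1 + ρ) :=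
          rpow_le_rpow (by positivity) hx hρ1.le
      _ = ∑ y, Q x ^ (1 + ρ) * W x y := by rw [← mul_sum, hW.2, mul_one]
      _ ≤ _ := sum_le_sum fun y _ => ?_
    have h2 : Q x ^ (1 + ρ) * W x y = (Q x * W x y ^ (1 / (1 + ρ))) ^ (1 + ρ) := by
      rw [mul_rpow hQx.le (rpow_nonneg (hW.1 x y) _), ← rpow_mul (hW.1 x y),
        one_div_mul_cancel hρ1.ne', rpow_one]
    have hnn : ∀ z, 0 ≤ Q z * W z y ^ (1 / (1 + ρ)) := fun z =>
      mul_nonneg (hQ.1 z) (rpow_nonneg (hW.1 z y) _)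
    rw [h2]
    exact rpow_le_rpow (hnn x) (single_le_sum (f := fun z => Q z * W z y ^ (1 / (1 + ρ)))
      (fun z _ => hnn z) (mem_univ x)) hρ1.le
  have h3 := log_le_log (by positivity) h1
  rw [log_rpow (by positivity), one_div, log_inv] at h3
  rw [Eo]
  linarith

lemma bddAbove_ESPset_of_Rinf_lt [Nonempty X] (hW : IsDMC W) {R : ℝ} (hR : Rinf W < R) :
    BddAbove (ESPset W R) := by
  by_contra h
  refine hR.not_ge (le_csSup ⟨Real.log (Fintype.card X), fun R' hR' => ?_⟩ h)
  by_contra! hlt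
  refine hR' ⟨Real.log (Fintype.card X), ?_⟩
  rintro e ⟨Q, hQ, ρ, hρ, rfl⟩
  nlinarith [Eo_le_mul_log_card hW hQ hρ]

lemma exists_infoDensity_lt [Nonempty X] (hW : IsDMC W) (hsing : Singular W) {R : ℝ}
    (hR : Rinf W < R) : ∃ y, 0 < outputDist W y ∧ infoDensity W y < R := by
  by_contra! h
  obtain ⟨R', hR', hR'R⟩ := exists_between hR
  obtain ⟨B, hB⟩ := bddAbove_ESPset_of_Rinf_lt hW hR'
  have key : ∀ ρ : ℝ, 0 ≤ ρ → ρ * (R - R') ≤ B := by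
    intro ρ hρ
    refine le_trans ?_ (hB ⟨_, isProbDist_uniform, ρ, hρ, rfl⟩)
    rw [Eo_uniform hW hsing hρ]
    have h1 : ∑ y, outputDist W y * exp (-(ρ * infoDensity W y)) ≤ exp (-(ρ * R)) := by
      calc _ ≤ ∑ y, outputDist W y * exp (-(ρ * R)) := sum_le_sum fun y _ => ?_
        _ = _ := by rw [← sum_mul, sum_outputDist hW, one_mul]
      rcases (outputDist_nonneg hW y).eq_or_lt with h0 | h0
      · simp [← h0]
      · have := h y h0
        gcongr
    have h0 : 0 < ∑ y, outputDist W y * exp (-(ρ * infoDensity W y)) := by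
      obtain ⟨y, -, hy⟩ := exists_lt_of_sum_lt (s := univ) (f := fun _ : Y => (0 : ℝ))
        (g := outputDist W) (by simp [sum_outputDist hW])
      exact sum_pos' (fun y _ => mul_nonneg (outputDist_nonneg hW y) (exp_pos _).le)
        ⟨y, mem_univ y, mul_pos hy (exp_pos _)⟩
    have h2 := log_le_log h0 h1
    rw [log_exp] at h2
    linarith
  have := key ((|B| + 1) / (R - R')) (div_nonneg (by positivity) (by linarith))
  rw [div_mul_cancel₀ _ (by linarith)] at this
  linarith [le_abs_self B]

lemma mutualInfo_le [Nonempty X] (hW : IsDMC W) (hsym : GallagerSymmetric W)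
    (hsing : Singular W) {Q : X → ℝ} (hQ : IsProbDist Q) :
    mutualInfo W Q ≤ ∑ y, outputDist W y * infoDensity W y := by
  set q : Y → ℝ := fun y => ∑ z, Q z * W z y with hq
  have hq0 : ∀ y, 0 ≤ q y := fun y => sum_nonneg fun z _ => mul_nonneg (hQ.1 z) (hW.1 z y)
  have hq1 : ∑ y, q y = 1 := by
    simp only [hq]
    rw [sum_comm, sum_congr rfl fun x _ => by rw [← mul_sum, hW.2, mul_one], hQ.2]
  have hterm : ∀ x y, Q x * W x y * Real.log (W x y / q y) ≤
      Q x * W x y * (infoDensity W y + outputDist W y / q y - 1) := by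
    intro x y
    rcases (mul_nonneg (hQ.1 x) (hW.1 x y)).eq_or_lt with h | h
    · rw [← h]; simp
    have hWx : 0 < W x y := pos_of_mul_pos_right h (hQ.1 x)
    have hqy : 0 < q y := h.trans_le (single_le_sum (f := fun z => Q z * W z y)
      (fun z _ => mul_nonneg (hQ.1 z) (hW.1 z y)) (mem_univ x))
    refine mul_le_mul_of_nonneg_left ?_ h.le
    have hμ : 0 < outputDist W y := by
      rw [outputDist_eq_of_pos hW hsing hWx]
      exact mul_pos (reachFrac_pos hWx) hWx
    have e : W x y / q y = exp (infoDensity W y) * (outputDist W y / q y) := by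
      rw [← mul_div_assoc, mul_comm (exp _), ← eq_outputDist_mul_exp hW hsing hWx]
    rw [e, log_mul (exp_pos _).ne' (by positivity), log_exp]
    linarith [log_le_sub_one_of_pos (show 0 < outputDist W y / q y by positivity)]
  have hcol : ∀ y, ∑ x, Q x * W x y * (infoDensity W y + outputDist W y / q y - 1) ≤
      q y * infoDensity W y + (outputDist W y - q y) := by
    intro y
    rw [← sum_mul]
    change q y * _ ≤ _
    rcases (hq0 y).eq_or_lt with h | h
    · rw [← h]; simpa using outputDist_nonneg hW y
    · apply le_of_eq
      field_simp
      ring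
  have hZ : ∑ y, q y * infoDensity W y = ∑ y, outputDist W y * infoDensity W y := by
    simp only [hq, sum_mul]
    rw [sum_comm]
    calc _ = ∑ x, Q x * ∑ y, W x y * infoDensity W y :=
          sum_congr rfl fun x _ => by rw [mul_sum]; exact sum_congr rfl fun y _ => by ring
      _ = ∑ x, Q x * ∑ y, outputDist W y * infoDensity W y :=
          sum_congr rfl fun x _ => by rw [sum_mul_infoDensity_eq hsym (fun t => t) x]
      _ = _ := by rw [← sum_mul, hQ.2, one_mul]
  calc mutualInfo W Q
      ≤ ∑ x, ∑ y, Q x * W x y * (infoDensity W y + outputDist W y / q y - 1) :=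
        sum_le_sum fun x _ => sum_le_sum fun y _ => hterm x y
    _ = ∑ y, ∑ x, Q x * W x y * (infoDensity W y + outputDist W y / q y - 1) := sum_comm
    _ ≤ ∑ y, (q y * infoDensity W y + (outputDist W y - q y)) := sum_le_sum fun y _ => hcol y
    _ = _ := by rw [sum_add_distrib, sum_sub_distrib, hZ, sum_outputDist hW, hq1]; ring

lemma capacity_le [Nonempty X] (hW : IsDMC W) (hsym : GallagerSymmetric W) (hsing : Singular W) :
    capacity W ≤ ∑ y, outputDist W y * infoDensity W y := by
  refine csSup_le ⟨_, _, isProbDist_uniform, rfl⟩ ?_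
  rintro r ⟨Q, hQ, rfl⟩
  exact mutualInfo_le hW hsym hsing hQ

omit [Fintype X] in
/-- If the law of `U` does not depend on the input, feedback does not affect the law of
the sum of `U` over the output word. -/
lemma sum_causal_eq_walk {μ U : Y → ℝ}
    (hinv : ∀ x, ∀ F : ℝ → ℝ, ∑ y, W x y * F (U y) = ∑ y, μ y * F (U y)) (g : ℝ → ℝ) (n : ℕ)
    (f : (Fin n → Y) → Fin n → X)
    (hf : ∀ y y' i, (∀ k, k < i → y k = y' k) → f y i = f y' i) (s : ℝ) :
    ∑ y : Fin n → Y, (∏ i, W (f y i) (y i)) * g (s + ∑ i, U (y i)) = walk μ U n g s := by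
  induction n generalizing s with
  | zero => simp [walk]
  | succ n ih =>
    rcases isEmpty_or_nonempty Y with hY | ⟨⟨y₀⟩⟩
    · simp [walk]
    have hx : ∀ y, f y 0 = f (fun _ => y₀) 0 := fun y =>
      hf _ _ _ fun k hk => absurd hk (Fin.not_lt_zero k)
    have h := hinv (f (fun _ => y₀) 0) fun u => walk μ U n g (s + u)
    rw [walk, ← h, ← (Fin.consEquiv fun _ => Y).sum_comp, Fintype.sum_prod_type]
    refine sum_congr rfl fun ω _ => ?_
    rw [← ih (fun y i => f (Fin.cons ω y) i.succ), mul_sum]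
    · refine sum_congr rfl fun y _ => ?_
      rw [Fin.prod_univ_succ, Fin.sum_univ_succ]
      simp only [Fin.consEquiv_apply, Fin.cons_zero, Fin.cons_succ]
      rw [hx, mul_assoc, add_assoc]
      rfl
    · intro y y' i hk
      refine hf _ _ _ fun k hki => ?_
      refine Fin.cases (fun _ => rfl) (fun j hj => ?_) k hki
      simpa using hk j (Fin.succ_lt_succ_iff.1 hj)

/-- Converse bound for feedback codes over a symmetric singular channel. -/
lemma walk_le_avgErrorProbFb [Nonempty X] (hW : IsDMC W) (hsym : GallagerSymmetric W)
    (hsing : Singular W) {R : ℝ} {N M : ℕ} (hM : exp (N * R) ≤ M)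
    (f : Fin M → (Fin N → Y) → Fin N → X) (φ : (Fin N → Y) → Fin M) (hf : Causal f) :
    walk (outputDist W) (fun y => infoDensity W y - R) N
      (fun s => if s < 0 then 1 - exp s else 0) 0 ≤ avgErrorProbFb W f φ := by
  classical
  set U : Y → ℝ := fun y => infoDensity W y - R with hU
  set μ := outputDist W with hμ
  set a : ℝ → ℝ := fun s => if s < 0 then 1 else 0 with ha
  have ha0 : ∀ s, 0 ≤ a s := fun s => by simp only [ha]; split_ifs <;> norm_num
  have ha1 : ∀ s, a s ≤ 1 := fun s => by simp only [ha]; split_ifs <;> norm_num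
  set S : (Fin N → Y) → ℝ := fun y => 0 + ∑ i, U (y i) with hS
  set P : Fin M → (Fin N → Y) → ℝ := fun m y => ∏ n, W (f m y n) (y n) with hP
  have hP0 : ∀ m y, 0 ≤ P m y := fun m y => prod_nonneg fun n _ => hW.1 _ _
  have hM0 : (0 : ℝ) < M := (exp_pos _).trans_le hM
  have hinv : ∀ x, ∀ F : ℝ → ℝ, ∑ y, W x y * F (U y) = ∑ y, μ y * F (U y) := fun x F =>
    sum_mul_infoDensity_eq hsym (fun t => F (t - R)) x
  have hA : ∀ m, ∑ y, P m y * a (S y) = walk μ U N a 0 := fun m =>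
    sum_causal_eq_walk hinv a N (f m) (hf m) 0
  have hm : ∀ m, walk μ U N a 0 - ∑ y, (if φ y = m then P m y * a (S y) else 0) ≤
      ∑ y ∈ univ.filter (fun y => φ y ≠ m), P m y := by
    intro m
    rw [← hA m, ← sum_sub_distrib, sum_filter]
    refine sum_le_sum fun y _ => ?_
    by_cases h : φ y = m
    · simp [h]
    · simpa [h] using mul_le_of_le_one_right (hP0 m y) (ha1 (S y))
  have hcorr : ∑ m, ∑ y, (if φ y = m then P m y * a (S y) else 0) ≤
      exp (N * R) * walk μ U N (fun s => exp s * a s) 0 := by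
    rw [sum_comm, ← sum_prod_mul_eq_walk, mul_sum]
    refine sum_le_sum fun y _ => ?_
    rw [sum_ite_eq, if_pos (mem_univ _)]
    have h1 : P (φ y) y ≤ ∏ i, (μ (y i) * exp (infoDensity W (y i))) :=
      prod_le_prod (fun _ _ => hW.1 _ _) fun _ _ => le_outputDist_mul_exp hW hsing _ _
    have h2 : ∏ i, (μ (y i) * exp (infoDensity W (y i))) =
        (∏ i, μ (y i)) * (exp (N * R) * exp (S y)) := by
      rw [prod_mul_distrib, ← exp_sum, ← exp_add]
      congr 2
      simp [hS, hU, sum_sub_distrib]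
    calc P (φ y) y * a (S y) ≤ (∏ i, μ (y i)) * (exp (N * R) * exp (S y)) * a (S y) :=
          mul_le_mul_of_nonneg_right (h1.trans h2.le) (ha0 _)
      _ = exp (N * R) * ((∏ i, μ (y i)) * (exp (S y) * a (S y))) := by ring
  have hB0 : 0 ≤ walk μ U N (fun s => exp s * a s) 0 :=
    walk_nonneg (outputDist_nonneg hW) U (fun s => mul_nonneg (exp_pos s).le (ha0 s)) N 0
  have hsum : (M : ℝ) * walk μ U N a 0 - exp (N * R) * walk μ U N (fun s => exp s * a s) 0 ≤
      ∑ m, ∑ y ∈ univ.filter (fun y => φ y ≠ m), P m y := by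
    have := sum_le_sum fun m (_ : m ∈ univ) => hm m
    rw [sum_sub_distrib, sum_const, card_univ, Fintype.card_fin, nsmul_eq_mul] at this
    linarith
  have hg : (fun s : ℝ => if s < 0 then 1 - exp s else 0) = fun s => a s - exp s * a s := by
    funext s
    simp only [ha]
    split_ifs <;> ring
  rw [hg, walk_sub, avgErrorProbFb, le_inv_mul_iff₀ hM0]
  refine le_trans ?_ hsum
  nlinarith

end Channel

lemma exists_tilt {Ω : Type*} [Fintype Ω] {μ U : Ω → ℝ} (hμ : ∀ ω, 0 ≤ μ ω)
    (hU : 0 < ∑ ω, μ ω * U ω) {ω₀ : Ω} (h0 : 0 < μ ω₀) (hU0 : U ω₀ < 0) :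
    ∃ ρ : ℝ, 0 < ρ ∧ ∑ ω, μ ω * exp (-(ρ * U ω)) * U ω = 0 := by
  classical
  set ψ : ℝ → ℝ := fun ρ => ∑ ω, μ ω * exp (-(ρ * U ω)) * U ω with hψ
  have hψ0 : 0 < ψ 0 := by simpa [hψ] using hU
  have hcont : Continuous ψ := by fun_prop
  set B : ℝ := ∑ ω, μ ω * |U ω| with hB
  have hB0 : 0 ≤ B := sum_nonneg fun ω _ => mul_nonneg (hμ ω) (abs_nonneg _)
  have hbound : ∀ ρ : ℝ, 0 ≤ ρ → ψ ρ ≤ B - ρ * (μ ω₀ * U ω₀ ^ 2) := by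
    intro ρ hρ
    have hterm : ∀ ω, μ ω * exp (-(ρ * U ω)) * U ω ≤
        μ ω * |U ω| - if ω = ω₀ then ρ * (μ ω₀ * U ω₀ ^ 2) else 0 := by
      intro ω
      have hexp : exp (-(ρ * U ω)) * U ω ≤ |U ω| := by
        rcases le_or_gt (U ω) 0 with h | h
        · exact (mul_nonpos_of_nonneg_of_nonpos (exp_pos _).le h).trans (abs_nonneg _)
        · rw [abs_of_pos h]
          exact mul_le_of_le_one_left h.le (exp_le_one_iff.2 (by nlinarith))
      split_ifs with h
      · subst h
        have h1 : -(ρ * U ω) ≤ exp (-(ρ * U ω)) := by linarith [add_one_le_exp (-(ρ * U ω))]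
        have h2 : exp (-(ρ * U ω)) * U ω ≤ -(ρ * U ω) * U ω :=
          mul_le_mul_of_nonpos_right h1 hU0.le
        have h3 := abs_nonneg (U ω)
        nlinarith [mul_le_mul_of_nonneg_left h2 (hμ ω), mul_nonneg (hμ ω) h3]
      · rw [sub_zero, mul_assoc]
        exact mul_le_mul_of_nonneg_left hexp (hμ ω)
    calc ψ ρ ≤ _ := sum_le_sum fun ω _ => hterm ω
      _ = _ := by rw [sum_sub_distrib, sum_ite_eq' univ ω₀, if_pos (mem_univ _)]
  have hc : 0 < μ ω₀ * U ω₀ ^ 2 := mul_pos h0 (by nlinarith)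
  set r : ℝ := B / (μ ω₀ * U ω₀ ^ 2) with hr
  have hr0 : 0 ≤ r := div_nonneg hB0 hc.le
  have hψr : ψ r ≤ 0 := by
    have := hbound r hr0
    rw [hr, div_mul_cancel₀ _ hc.ne'] at this
    linarith
  obtain ⟨ρ, hρ, h⟩ := intermediate_value_Icc' hr0 hcont.continuousOn ⟨hψr, hψ0.le⟩
  refine ⟨ρ, lt_of_le_of_ne hρ.1 ?_, h⟩
  rintro rfl
  exact hψ0.ne' h

/-- An eventual lower bound of order `1 / √N` for a positive sequence holds for all `N ≥ 1`
with a smaller constant. -/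
lemma exists_forall_div_sqrt_le {u : ℕ → ℝ} (hu : ∀ N, 0 < N → 0 < u N) {K : ℝ} (hK : 0 < K)
    {N₀ : ℕ} (h : ∀ N, N₀ ≤ N → K / √N ≤ u N) :
    ∃ K' : ℝ, 0 < K' ∧ ∀ N : ℕ, 0 < N → K' / √N ≤ u N := by
  induction N₀ generalizing K with
  | zero => exact ⟨K, hK, fun N _ => h N (Nat.zero_le N)⟩
  | succ n ih =>
    rcases n.eq_zero_or_pos with rfl | hn
    · exact ⟨K, hK, fun N hN => h N hN⟩
    have hsn : 0 < √(n : ℝ) := sqrt_pos.2 (by exact_mod_cast hn)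
    refine ih (K := min K (u n * √n)) (lt_min hK (mul_pos (hu n hn) hsn)) fun N hN => ?_
    rcases hN.eq_or_lt with rfl | hlt
    · rw [div_le_iff₀ hsn]
      exact min_le_right _ _
    · exact (div_le_div_of_nonneg_right (min_le_left _ _) (sqrt_nonneg _)).trans (h N hlt)

/-- **Theorem 2(ii)** (singular converse with feedback): for a symmetric singular DMC with
`R_cr < C(W)` and any rate `R_∞ < R < C(W)`, there is a constant `K̃₂ > 0` such that for every
blocklength `N ≥ 1`, every `(N,R)` code with ideal feedback has average error probability at
least `(K̃₂/√N) · exp(-N E_SP(R))`. -/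
theorem statement3 {X Y : Type} [Fintype X] [Fintype Y] [Nonempty X] [Nonempty Y]
    (W : X → Y → ℝ) (hW : IsDMC W) (hsym : GallagerSymmetric W) (hsing : Singular W)
    (hcr : Rcr W < capacity W)
    (R : ℝ) (hR1 : Rinf W < R) (hR2 : R < capacity W) :
    ∃ K₂ : ℝ, 0 < K₂ ∧ ∀ N : ℕ, 0 < N →
      ∀ (f : Fin (Mof N R) → (Fin N → Y) → Fin N → X) (φ : (Fin N → Y) → Fin (Mof N R)),
        Causal f →
          K₂ / Real.sqrt N * Real.exp (-(N : ℝ) * ESP W R) ≤ avgErrorProbFb W f φ := by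
  set μ := outputDist W with hμ
  set U : Y → ℝ := fun y => infoDensity W y - R with hU
  have hμ0 : ∀ y, 0 ≤ μ y := outputDist_nonneg hW
  have hμ1 : ∑ y, μ y = 1 := sum_outputDist hW
  obtain ⟨y₀, hy₀, hlt⟩ := exists_infoDensity_lt hW hsing hR1
  have hUy₀ : U y₀ < 0 := sub_neg.2 hlt
  have hmean : 0 < ∑ y, μ y * U y := by
    simp only [hU, mul_sub, sum_sub_distrib, ← sum_mul, hμ1]
    linarith [capacity_le hW hsym hsing]
  obtain ⟨ρ, hρ, htilt⟩ := exists_tilt hμ0 hmean hy₀ hUy₀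
  obtain ⟨y₁, -, hy₁⟩ := exists_lt_of_sum_lt (s := univ) (f := fun _ : Y => (0 : ℝ))
    (g := fun y => μ y * U y) (by simpa using hmean)
  have hUy₁ : 0 < U y₁ := pos_of_mul_pos_right hy₁ (hμ0 y₁)
  have hμy₁ : 0 < μ y₁ := pos_of_mul_pos_left hy₁ hUy₁.le
  set Φ : ℝ := ∑ y, μ y * exp (-(ρ * U y)) with hΦ
  have hΦ0 : 0 < Φ := sum_pos' (fun y _ => mul_nonneg (hμ0 y) (exp_pos _).le)
    ⟨y₀, mem_univ _, mul_pos hy₀ (exp_pos _)⟩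
  set ν : Y → ℝ := fun y => μ y * exp (-(ρ * U y)) / Φ with hν
  have hν0 : ∀ y, 0 ≤ ν y := fun y => div_nonneg (mul_nonneg (hμ0 y) (exp_pos _).le) hΦ0.le
  have hνpos : ∀ y, 0 < μ y → 0 < ν y := fun y hy => div_pos (mul_pos hy (exp_pos _)) hΦ0
  have hν1 : ∑ y, ν y = 1 := by rw [← sum_div, div_self hΦ0.ne']
  have hνU : ∑ y, ν y * U y = 0 := by
    simp only [hν, div_mul_eq_mul_div]
    rw [← sum_div, htilt, zero_div]
  have hμν : ∀ y, μ y = Φ * ν y * exp (ρ * U y) := by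
    intro y
    simp only [hν]
    rw [mul_div_cancel₀ _ hΦ0.ne', mul_assoc, ← exp_add, neg_add_cancel, exp_zero, mul_one]
  have hESP : exp (-ESP W R) ≤ Φ := by
    have h : Eo W (fun _ => 1 / Fintype.card X) ρ - ρ * R ≤ ESP W R :=
      le_csSup (bddAbove_ESPset_of_Rinf_lt hW hR1) ⟨_, isProbDist_uniform, ρ, hρ.le, rfl⟩
    have hΦ' : Φ = exp (ρ * R) * ∑ y, μ y * exp (-(ρ * infoDensity W y)) := by
      rw [hΦ, mul_sum]
      refine sum_congr rfl fun y _ => ?_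
      rw [mul_left_comm, ← exp_add]
      congr 2
      simp only [hU]
      ring
    have hlog : Real.log Φ = ρ * R - Eo W (fun _ => 1 / Fintype.card X) ρ := by
      have hpos : 0 < ∑ y, μ y * exp (-(ρ * infoDensity W y)) :=
        pos_of_mul_pos_right (hΦ' ▸ hΦ0) (exp_pos _).le
      rw [hΦ', log_mul (exp_pos _).ne' hpos.ne', log_exp, Eo_uniform hW hsing hρ.le]
      ring
    rw [← exp_log hΦ0]
    exact exp_le_exp.2 (by linarith)
  set g : ℝ → ℝ := fun s => if s < 0 then 1 - exp s else 0 with hg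
  set h : ℝ → ℝ := fun s => exp (ρ * s) * g s with hh
  have hh_neg : ∀ s < 0, 0 < h s := fun s hs => by
    simp only [hh, hg, if_pos hs]
    exact mul_pos (exp_pos _) (sub_pos.2 (exp_lt_one_iff.2 hs))
  have hh_nonneg : ∀ s, 0 ≤ h s := fun s => by
    rcases lt_or_ge s 0 with hs | hs
    · exact (hh_neg s hs).le
    · simp [hh, hg, hs.not_gt]
  set d := U y₁ - U y₀ with hd
  set κ : ℝ := exp (ρ * (-1 - d)) * (1 - exp (-1)) with hκ
  have hκ0 : 0 < κ := mul_pos (exp_pos _) (sub_pos.2 (exp_lt_one_iff.2 (by norm_num)))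
  have hh_window : ∀ s, -1 - d ≤ s → s ≤ -1 → 1 ≤ κ⁻¹ * h s := by
    intro s hs1 hs2
    rw [le_inv_mul_iff₀ hκ0, mul_one]
    simp only [hh, hg, if_pos (show s < 0 by linarith)]
    have hexp : exp (-1) < 1 := exp_lt_one_iff.2 (by norm_num)
    refine mul_le_mul ?_ ?_ (by linarith) (exp_pos _).le
    · gcongr
    · gcongr
  obtain ⟨K, hK, N₀, hlocal⟩ := exists_le_walk_window hν0 hν1 hνU (hνpos _ hy₀) (hνpos _ hμy₁)
    (hUy₀.trans hUy₁) (g := fun s => κ⁻¹ * h s)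
    (fun s => mul_nonneg (inv_nonneg.2 hκ0.le) (hh_nonneg s)) hh_window
  have hpos : ∀ N, 0 < N → 0 < walk ν U N h 0 := by
    intro N hN
    obtain ⟨n, rfl⟩ := Nat.exists_eq_succ_of_ne_zero hN.ne'
    exact (mul_pos (hνpos _ hy₀) (walk_pos hν0 hh_nonneg hh_neg (hνpos _ hy₀) hUy₀ n (0 + U y₀)
      (by linarith))).trans_le (single_le_sum (f := fun ω => ν ω * walk ν U n h (0 + U ω))
        (fun ω _ => mul_nonneg (hν0 ω) (walk_nonneg hν0 U hh_nonneg n _)) (mem_univ y₀))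
  obtain ⟨K', hK', hwalk⟩ := exists_forall_div_sqrt_le hpos (mul_pos hκ0 hK) (N₀ := N₀)
    fun N hN => by
      have := hlocal N hN
      rwa [walk_const_mul, le_inv_mul_iff₀ hκ0, ← mul_div_assoc] at this
  refine ⟨K', hK', fun N hN f φ hf => ?_⟩
  refine le_trans ?_ (walk_le_avgErrorProbFb hW hsym hsing (Nat.le_ceil _) f φ hf)
  rw [walk_tilt U hμν, mul_zero, neg_zero, exp_zero, mul_one, mul_comm]
  refine mul_le_mul ?_ (hwalk N hN) (by positivity) (by positivity)
  rw [neg_mul, ← mul_neg, exp_nat_mul]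
  exact pow_le_pow_left₀ (exp_pos _).le hESP N
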